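/- Let k be a field, p ≥ 1 an integer, n = 2p, and let I be the ideal of R = k[x_1,…,x_n] generated by the square-free quadratic monomials x_1x_2, x_2x_3, …, x_{n−1}x_n, x_nx_1 (the edge ideal of a cycle of even length n = 2p). Then rt(I) = p. -/

import Mathlib

open Polynomial MvPolynomial

/-- The kernel of the graded presentation `R[t₁,…,t_s] → 𝐑(I) ⊆ R[X]` of the Rees algebra
of the ideal generated by `f`, sending `tᵢ` to `(f i)·X`. -/
noncomputable def reesKer {R : Type*} [CommRing R] {s : ℕ} (f : Fin s → R) :
    Ideal (MvPolynomial (Fin s) R) :=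
  RingHom.ker (MvPolynomial.aeval
    (fun i => Polynomial.C (f i) * Polynomial.X) : MvPolynomial (Fin s) R →ₐ[R] Polynomial R)

/-- `L` is generated by its homogeneous elements of degree at most `N`. -/
def GenInDegLE {R : Type*} [CommRing R] {s : ℕ}
    (L : Ideal (MvPolynomial (Fin s) R)) (N : ℕ) : Prop :=
  L = Ideal.span {p | p ∈ L ∧ ∃ q ≤ N, MvPolynomial.IsHomogeneous p q}

/-- The relation type of an ideal `I`: the least `N ≥ 1` such that, for every finite
generating family of `I`, the ideal of equations of the corresponding presentation of the
Rees algebra is generated by its homogeneous elements of degree at most `N`. -/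
noncomputable def relType {R : Type*} [CommRing R] (I : Ideal R) : ℕ :=
  sInf {N | 1 ≤ N ∧ ∀ (s : ℕ) (f : Fin s → R),
    Ideal.span (Set.range f) = I → GenInDegLE (reesKer f) N}

section Combinatorics

/-- The cyclic successor on `Fin n`. -/
def cycSucc {n : ℕ} (i : Fin n) : Fin n :=
  ⟨((i : ℕ) + 1) % n, Nat.mod_lt _ i.pos⟩

theorem cycSucc_surjective {n : ℕ} : Function.Surjective (cycSucc (n := n)) := by
  intro i
  have hi := i.isLt
  rcases Nat.eq_zero_or_pos (i : ℕ) with h | h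
  · refine ⟨⟨n - 1, by omega⟩, Fin.ext ?_⟩
    simp [cycSucc, h, Nat.sub_add_cancel i.pos]
  · refine ⟨⟨i - 1, by omega⟩, Fin.ext ?_⟩
    simp [cycSucc, Nat.sub_add_cancel h, Nat.mod_eq_of_lt hi]

theorem cycSucc_injective {n : ℕ} : Function.Injective (cycSucc (n := n)) :=
  Finite.injective_iff_surjective.mpr cycSucc_surjective

theorem cycSucc_mod_two {p : ℕ} (i : Fin (2 * p)) :
    (cycSucc i : ℕ) % 2 = ((i : ℕ) + 1) % 2 := by
  simp [cycSucc]

theorem cycSucc_ne {p : ℕ} (i : Fin (2 * p)) : cycSucc i ≠ i := by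
  intro h
  have := cycSucc_mod_two i
  rw [h] at this
  omega

/-- On an even cycle, two properties that imply each other at consecutive positions and hold
somewhere hold alternately along the whole cycle. -/
theorem alternating_of_cycSucc {p : ℕ} {A B : Fin (2 * p) → Prop}
    (hAB : ∀ i, A i → B (cycSucc i)) (hBA : ∀ i, B i → A (cycSucc i))
    {l : Fin (2 * p)} (hl : A l) (i : Fin (2 * p)) :
    if (i : ℕ) % 2 = (l : ℕ) % 2 then A i else B i := by
  have hn : 0 < 2 * p := l.pos
  have key : ∀ m : ℕ, if m % 2 = 0 then A ⟨(l + m) % (2 * p), Nat.mod_lt _ hn⟩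
      else B ⟨(l + m) % (2 * p), Nat.mod_lt _ hn⟩ := by
    intro m
    induction m with
    | zero => simpa [Nat.mod_eq_of_lt l.isLt] using hl
    | succ m ih =>
      have hs : (⟨(l + (m + 1)) % (2 * p), Nat.mod_lt _ hn⟩ : Fin (2 * p)) =
          cycSucc ⟨(l + m) % (2 * p), Nat.mod_lt _ hn⟩ := by
        apply Fin.ext
        simp [cycSucc, add_assoc]
      rw [hs]
      rcases Nat.mod_two_eq_zero_or_one m with h | h
      · rw [if_pos h] at ih
        rw [if_neg (by omega)]
        exact hAB _ ih
      · rw [if_neg (by omega)] at ih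
        rw [if_pos (by omega)]
        exact hBA _ ih
  have h := key (i + 2 * p - l)
  have hi := i.isLt
  have hl' := l.isLt
  have e : (⟨(l + (i + 2 * p - l)) % (2 * p), Nat.mod_lt _ hn⟩ : Fin (2 * p)) = i := by
    apply Fin.ext
    have : (l : ℕ) + (i + 2 * p - l) = i + 2 * p := by omega
    simp [this, Nat.mod_eq_of_lt hi]
  rw [e] at h
  split_ifs at h ⊢ <;> first | exact h | omega

/-- The exponent of the product of the edges of a cycle with multiplicities `α`. -/
noncomputable def cycIncidence {n : ℕ} (α : Fin n →₀ ℕ) : Fin n →₀ ℕ :=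
  α + α.mapDomain cycSucc

theorem cycIncidence_add {n : ℕ} (α β : Fin n →₀ ℕ) :
    cycIncidence (α + β) = cycIncidence α + cycIncidence β := by
  simp only [cycIncidence, Finsupp.mapDomain_add]
  abel

theorem cycIncidence_zero {n : ℕ} : cycIncidence (0 : Fin n →₀ ℕ) = 0 := by
  simp [cycIncidence]

theorem cycIncidence_single {n : ℕ} (i : Fin n) :
    cycIncidence (Finsupp.single i 1) = Finsupp.single i 1 + Finsupp.single (cycSucc i) 1 := by
  simp [cycIncidence, Finsupp.mapDomain_single]

theorem cycIncidence_apply {n : ℕ} (α : Fin n →₀ ℕ) (i : Fin n) :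
    cycIncidence α (cycSucc i) = α (cycSucc i) + α i := by
  simp [cycIncidence, Finsupp.mapDomain_apply cycSucc_injective]

theorem degree_cycIncidence {n : ℕ} (α : Fin n →₀ ℕ) :
    (cycIncidence α).degree = 2 * α.degree := by
  simp [cycIncidence, Finsupp.degree_mapDomain, two_mul]

/-- The indicator function of the positions of parity `r`. -/
noncomputable def parityInd (p r : ℕ) : Fin (2 * p) →₀ ℕ :=
  Finsupp.equivFunOnFinite.symm fun i => if (i : ℕ) % 2 = r then 1 else 0

theorem parityInd_apply (p r : ℕ) (i : Fin (2 * p)) :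
    parityInd p r i = if (i : ℕ) % 2 = r then 1 else 0 := rfl

theorem cycIncidence_parityInd {p r : ℕ} (hr : r < 2) (i : Fin (2 * p)) :
    cycIncidence (parityInd p r) i = 1 := by
  obtain ⟨i, rfl⟩ := cycSucc_surjective i
  rw [cycIncidence_apply, parityInd_apply, parityInd_apply, cycSucc_mod_two]
  split_ifs <;> omega

theorem degree_parityInd {p r : ℕ} (hr : r < 2) : (parityInd p r).degree = p := by
  have h := degree_cycIncidence (parityInd p r)
  rw [Finsupp.degree_eq_sum] at h
  simp only [cycIncidence_parityInd hr, Finset.sum_const, Finset.card_univ, Fintype.card_fin,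
    smul_eq_mul, mul_one] at h
  omega

theorem cycIncidence_parityInd_eq {p r s : ℕ} (hr : r < 2) (hs : s < 2) :
    cycIncidence (parityInd p r) = cycIncidence (parityInd p s) := by
  ext i
  rw [cycIncidence_parityInd hr, cycIncidence_parityInd hs]

theorem parityInd_le {p r : ℕ} {α : Fin (2 * p) →₀ ℕ}
    (h : ∀ i : Fin (2 * p), (i : ℕ) % 2 = r → 0 < α i) : parityInd p r ≤ α := by
  intro i
  rw [parityInd_apply]
  split_ifs with hi
  · exact h i hi
  · exact Nat.zero_le _

/-- Fewer than `p` edges of the cycle of length `2p` are determined by their product. -/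
theorem eq_of_cycIncidence_eq {p : ℕ} {α β : Fin (2 * p) →₀ ℕ} (hα : α.degree < p)
    (h : cycIncidence α = cycIncidence β) : α = β := by
  have hs : ∀ i, α (cycSucc i) + α i = β (cycSucc i) + β i := fun i => by
    rw [← cycIncidence_apply, h, cycIncidence_apply]
  have main : ∀ l, ¬ β l < α l := by
    intro l hl
    have alt := alternating_of_cycSucc (A := fun i => β i < α i) (B := fun i => α i < β i)
      (fun i hi => by have := hs i; omega) (fun i hi => by have := hs i; omega) hl
    have hle : parityInd p (l % 2) ≤ α := parityInd_le fun i hi => by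
      have := alt i
      rw [if_pos hi] at this
      omega
    have := Finsupp.degree_mono hle
    rw [degree_parityInd (Nat.mod_lt _ two_pos)] at this
    omega
  ext i
  obtain ⟨j, rfl⟩ := cycSucc_surjective i
  have h1 := main j
  have h2 := main (cycSucc j)
  have h3 := hs j
  omega

end Combinatorics

section EdgeMonomials

variable {k : Type*} [Field k] {n : ℕ}

/-- The monomial `x ^ a * t ^ α` of `k[x][t]`. -/
noncomputable def reesMonomial (k : Type*) [Field k] {n : ℕ} (a α : Fin n →₀ ℕ) :
    MvPolynomial (Fin n) (MvPolynomial (Fin n) k) :=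
  MvPolynomial.monomial α (MvPolynomial.monomial a 1)

theorem reesMonomial_add (a b α β : Fin n →₀ ℕ) :
    reesMonomial k (a + b) (α + β) = reesMonomial k a α * reesMonomial k b β := by
  simp [reesMonomial, MvPolynomial.monomial_mul]

/-- The monomials `x ^ a * t ^ α` and `x ^ b * t ^ β` have the same image in the Rees algebra of
the edge ideal of a cycle. -/
def SameImage (a α b β : Fin n →₀ ℕ) : Prop :=
  a + cycIncidence α = b + cycIncidence β ∧ α.degree = β.degree

theorem SameImage.symm {a α b β : Fin n →₀ ℕ} (h : SameImage a α b β) : SameImage b β a α :=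
  ⟨h.1.symm, h.2.symm⟩

theorem SameImage.trans {a α b β c γ : Fin n →₀ ℕ} (h : SameImage a α b β)
    (h' : SameImage b β c γ) : SameImage a α c γ :=
  ⟨h.1.trans h'.1, h.2.trans h'.2⟩

theorem SameImage.add_left {b β c γ : Fin n →₀ ℕ} (a α : Fin n →₀ ℕ) (h : SameImage b β c γ) :
    SameImage (a + b) (α + β) (a + c) (α + γ) := by
  refine ⟨?_, by simp [h.2]⟩
  rw [cycIncidence_add, cycIncidence_add, add_add_add_comm, h.1, add_add_add_comm]

theorem SameImage.of_add_left {a α b β c γ : Fin n →₀ ℕ}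
    (h : SameImage (a + b) (α + β) (a + c) (α + γ)) : SameImage b β c γ := by
  obtain ⟨h1, h2⟩ := h
  rw [cycIncidence_add, cycIncidence_add, add_add_add_comm, add_add_add_comm a c] at h1
  exact ⟨add_left_cancel h1, by simpa using h2⟩

theorem single_one_le {f : Fin n →₀ ℕ} {i : Fin n} : Finsupp.single i 1 ≤ f ↔ 0 < f i := by
  rw [Finsupp.single_le_iff]
  exact Iff.rfl

theorem sameImage_linear {a b : Fin n →₀ ℕ} {i j : Fin n}
    (h : a + (Finsupp.single i 1 + Finsupp.single (cycSucc i) 1) =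
      b + (Finsupp.single j 1 + Finsupp.single (cycSucc j) 1)) :
    SameImage a (Finsupp.single i 1) b (Finsupp.single j 1) := by
  refine ⟨?_, by simp⟩
  rw [cycIncidence_single, cycIncidence_single, h]

/-- If an edge of `β` has an endpoint in `a` while `α` and `β` are disjoint, a linear relation
turns an edge of `α` into an edge of `β`. -/
theorem exists_linear_move {p : ℕ} {a α b β : Fin (2 * p) →₀ ℕ} (h : SameImage a α b β)
    (hdis : ∀ i, ¬ (0 < α i ∧ 0 < β i)) {i : Fin (2 * p)} (hi : 0 < β i)
    (ha : 0 < a i ∨ 0 < a (cycSucc i)) :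
    ∃ (j : Fin (2 * p)) (c d : Fin (2 * p) →₀ ℕ), 0 < α j ∧ c ≤ a ∧
      SameImage c (Finsupp.single j 1) d (Finsupp.single i 1) := by
  have hs : ∀ j, a (cycSucc j) + (α (cycSucc j) + α j) = b (cycSucc j) + (β (cycSucc j) + β j) :=
    fun j => by
      rw [← cycIncidence_apply, ← cycIncidence_apply]
      exact DFunLike.congr_fun h.1 (cycSucc j)
  have hαi : α i = 0 := by have := hdis i; omega
  obtain ⟨j, hj⟩ := cycSucc_surjective i
  have h1 := hs i
  have h2 := hs j
  rw [hj] at h2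
  by_cases hai : 0 < a i
  · by_cases hai' : 0 < a (cycSucc i)
    · obtain ⟨j, hj⟩ : ∃ j, 0 < α j := by
        by_contra! hc
        have hα : α = 0 := by
          ext j
          simpa using hc j
        have h3 := h.2
        rw [hα, map_zero] at h3
        have h4 := β.le_degree i
        omega
      refine ⟨j, Finsupp.single i 1 + Finsupp.single (cycSucc i) 1,
        Finsupp.single j 1 + Finsupp.single (cycSucc j) 1, hj, ?_, sameImage_linear (add_comm _ _)⟩
      intro v
      have hne := cycSucc_ne i
      simp only [Finsupp.add_apply, Finsupp.single_apply]
      split_ifs with hv hv' hv' <;> subst_vars <;> omega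
    · exact ⟨cycSucc i, Finsupp.single i 1, Finsupp.single (cycSucc (cycSucc i)) 1, by omega,
        single_one_le.mpr hai, sameImage_linear (by abel)⟩
  · exact ⟨j, Finsupp.single (cycSucc i) 1, Finsupp.single j 1, by omega,
      single_one_le.mpr (by omega), sameImage_linear (by rw [hj]; abel)⟩

/-- If an ideal contains all binomial relations of degree at most `p` of the edge ideal of the
cycle of length `2p`, then it contains all binomial relations. -/
theorem reesMonomial_sub_mem {p : ℕ} (hp : 1 ≤ p)
    {M : Ideal (MvPolynomial (Fin (2 * p)) (MvPolynomial (Fin (2 * p)) k))}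
    (hM : ∀ a α b β, SameImage a α b β → α.degree ≤ p →
      reesMonomial k a α - reesMonomial k b β ∈ M) (q : ℕ) :
    ∀ a α b β, SameImage a α b β → α.degree = q →
      reesMonomial k a α - reesMonomial k b β ∈ M := by
  induction q with
  | zero => exact fun a α b β h hq => hM a α b β h (by omega)
  | succ q ih =>
    have common : ∀ a α b β, SameImage a α b β → α.degree = q + 1 → (∃ i, 0 < α i ∧ 0 < β i) →
        reesMonomial k a α - reesMonomial k b β ∈ M := by
      rintro a α b β h hq ⟨i, hα, hβ⟩
      obtain ⟨α', rfl⟩ := exists_add_of_le (single_one_le.mpr hα)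
      obtain ⟨β', rfl⟩ := exists_add_of_le (single_one_le.mpr hβ)
      rw [← zero_add a, ← zero_add b] at h ⊢
      rw [reesMonomial_add, reesMonomial_add, ← mul_sub]
      refine M.mul_mem_left _ (ih _ _ _ _ h.of_add_left ?_)
      simp at hq
      omega
    have move : ∀ a α b β c γ d δ, SameImage a α b β → α.degree = q + 1 → c ≤ a → γ ≤ α →
        SameImage c γ d δ → γ.degree ≤ p → (∃ i, 0 < δ i ∧ 0 < β i) →
        reesMonomial k a α - reesMonomial k b β ∈ M := by
      rintro a α b β c γ d δ h hq hc hγ hm hp' ⟨i, hδ, hβ⟩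
      obtain ⟨a', rfl⟩ := exists_add_of_le hc
      obtain ⟨α', rfl⟩ := exists_add_of_le hγ
      rw [add_comm c, add_comm γ] at h ⊢
      rw [add_comm γ] at hq
      have h' := hm.add_left a' α'
      rw [← sub_add_sub_cancel _ (reesMonomial k (a' + d) (α' + δ))]
      refine M.add_mem ?_ (common _ _ _ _ (h'.symm.trans h) (h'.2.symm.trans hq) ⟨i, ?_, hβ⟩)
      · rw [reesMonomial_add, reesMonomial_add, ← mul_sub]
        exact M.mul_mem_left _ (hM _ _ _ _ hm hp')
      · rw [Finsupp.add_apply]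
        omega
    have endpoint : ∀ a α b β, SameImage a α b β → α.degree = q + 1 →
        (∀ i, ¬ (0 < α i ∧ 0 < β i)) → (∃ i, 0 < β i ∧ (0 < a i ∨ 0 < a (cycSucc i))) →
        reesMonomial k a α - reesMonomial k b β ∈ M := by
      rintro a α b β h hq hdis ⟨i, hi, ha⟩
      obtain ⟨j, c, d, hj, hc, hm⟩ := exists_linear_move h hdis hi ha
      exact move a α b β c _ d _ h hq hc (single_one_le.mpr hj) hm (by simpa using hp)
        ⟨i, by simp, hi⟩
    intro a α b β h hq
    by_cases hdis : ∃ i, 0 < α i ∧ 0 < β i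
    · exact common a α b β h hq hdis
    push Not at hdis
    by_cases hβa : ∃ i, 0 < β i ∧ (0 < a i ∨ 0 < a (cycSucc i))
    · exact endpoint a α b β h hq (by simpa using hdis) hβa
    by_cases hαb : ∃ i, 0 < α i ∧ (0 < b i ∨ 0 < b (cycSucc i))
    · rw [← neg_mem_iff, neg_sub]
      refine endpoint b β a α h.symm (h.2.symm.trans hq) (fun i hi => ?_) hαb
      have := hdis i
      omega
    push Not at hβa hαb
    obtain ⟨l, hl⟩ : ∃ l, 0 < β l := by
      by_contra! hc
      have hβ : β = 0 := by
        ext j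
        simpa using hc j
      have h3 := h.2
      rw [hβ, map_zero] at h3
      omega
    have hs : ∀ j, a (cycSucc j) + (α (cycSucc j) + α j) =
        b (cycSucc j) + (β (cycSucc j) + β j) := fun j => by
      rw [← cycIncidence_apply, ← cycIncidence_apply]
      exact DFunLike.congr_fun h.1 (cycSucc j)
    have alt := alternating_of_cycSucc (A := fun i => 0 < β i) (B := fun i => 0 < α i)
      (fun i hi => by
        have h1 := hs i
        have h2 := hβa i hi
        have h3 := hdis i
        omega)
      (fun i hi => by
        have h1 := hs i
        have h2 := hαb i hi
        have h3 := hdis i hi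
        omega) hl
    have hr : (l : ℕ) % 2 < 2 := Nat.mod_lt _ two_pos
    have hr' : 1 - (l : ℕ) % 2 < 2 := by omega
    refine move a α b β 0 (parityInd p (1 - l % 2)) 0 (parityInd p (l % 2)) h hq
      zero_le (parityInd_le fun i hi => ?_)
      ⟨by rw [cycIncidence_parityInd_eq hr' hr], by rw [degree_parityInd hr', degree_parityInd hr]⟩
      (degree_parityInd hr').le ⟨l, by simp [parityInd_apply], hl⟩
    have := alt i
    rwa [if_neg (by omega)] at this

end EdgeMonomials

section GeneratingSets

variable {R : Type*} [CommRing R]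

theorem mem_reesKer {s : ℕ} {f : Fin s → R} {P : MvPolynomial (Fin s) R} :
    P ∈ reesKer f ↔ MvPolynomial.aeval
      (fun i => Polynomial.C (f i) * Polynomial.X : Fin s → Polynomial R) P = 0 :=
  Iff.rfl

/-- Generation in degrees at most `N ≥ 1` of the ideal of equations does not depend on the
generating family. -/
theorem GenInDegLE.of_span_eq {s m N : ℕ} {f : Fin s → R} {g : Fin m → R} (hN : 1 ≤ N)
    (hfg : Ideal.span (Set.range f) = Ideal.span (Set.range g))
    (hf : GenInDegLE (reesKer f) N) : GenInDegLE (reesKer g) N := by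
  have hgf : ∀ j, ∃ c : Fin s → R, ∑ i, c i * f i = g j := fun j =>
    Ideal.mem_span_range_iff_exists_fun.mp (hfg ▸ Ideal.subset_span ⟨j, rfl⟩)
  have hfg' : ∀ i, ∃ c : Fin m → R, ∑ j, c j * g j = f i := fun i =>
    Ideal.mem_span_range_iff_exists_fun.mp (hfg.symm ▸ Ideal.subset_span ⟨i, rfl⟩)
  choose u hu using hgf
  choose v hv using hfg'
  let F : Fin m → MvPolynomial (Fin s) R := fun j => ∑ i, MvPolynomial.C (u j i) * MvPolynomial.X i
  let G : Fin s → MvPolynomial (Fin m) R := fun i => ∑ j, MvPolynomial.C (v i j) * MvPolynomial.X j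
  have hF : ∀ j, (F j).IsHomogeneous 1 := fun j =>
    MvPolynomial.IsHomogeneous.sum _ _ _ fun i _ => MvPolynomial.isHomogeneous_C_mul_X _ _
  have hG : ∀ i, (G i).IsHomogeneous 1 := fun i =>
    MvPolynomial.IsHomogeneous.sum _ _ _ fun j _ => MvPolynomial.isHomogeneous_C_mul_X _ _
  let φf : MvPolynomial (Fin s) R →ₐ[R] Polynomial R :=
    MvPolynomial.aeval fun i => Polynomial.C (f i) * Polynomial.X
  let φg : MvPolynomial (Fin m) R →ₐ[R] Polynomial R :=
    MvPolynomial.aeval fun i => Polynomial.C (g i) * Polynomial.X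
  have hφF : φf.comp (MvPolynomial.aeval F) = φg := by
    refine MvPolynomial.algHom_ext fun j => ?_
    simp only [φf, φg, F, AlgHom.comp_apply, MvPolynomial.aeval_X, map_sum, map_mul,
      MvPolynomial.algHom_C, Polynomial.algebraMap_eq, ← hu, Finset.sum_mul, mul_assoc]
  have hφG : φg.comp (MvPolynomial.aeval G) = φf := by
    refine MvPolynomial.algHom_ext fun j => ?_
    simp only [φf, φg, G, AlgHom.comp_apply, MvPolynomial.aeval_X, map_sum, map_mul,
      MvPolynomial.algHom_C, Polynomial.algebraMap_eq, ← hv, Finset.sum_mul, mul_assoc]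
  let M : Ideal (MvPolynomial (Fin m) R) :=
    Ideal.span {P | P ∈ reesKer g ∧ ∃ q ≤ N, MvPolynomial.IsHomogeneous P q}
  have hback : ∀ P ∈ reesKer f, MvPolynomial.aeval G P ∈ M := by
    intro P hP
    rw [hf] at hP
    have hle : Ideal.span {P | P ∈ reesKer f ∧ ∃ q ≤ N, MvPolynomial.IsHomogeneous P q} ≤
        M.comap (MvPolynomial.aeval G) := by
      refine Ideal.span_le.mpr fun P hP => Ideal.subset_span ⟨?_, ?_⟩
      · exact (DFunLike.congr_fun hφG P).trans hP.1
      · obtain ⟨q, hq, hPq⟩ := hP.2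
        exact ⟨q, hq, by simpa using hPq.aeval G hG⟩
    exact hle hP
  have hsub : ∀ P, P - MvPolynomial.aeval G (MvPolynomial.aeval F P) ∈ M := by
    have hcomp : (Ideal.Quotient.mkₐ R M).comp
        ((MvPolynomial.aeval G).comp (MvPolynomial.aeval F)) = Ideal.Quotient.mkₐ R M := by
      refine MvPolynomial.algHom_ext fun j => ?_
      have hspan : ∀ P ∈ reesKer g, P.IsHomogeneous 1 → P ∈ M := fun P h h' =>
        Ideal.subset_span ⟨h, 1, hN, h'⟩
      refine (Ideal.Quotient.eq.mpr (hspan _ ?_ ?_)).symm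
      · rw [mem_reesKer, map_sub, sub_eq_zero]
        change φg _ = φg (MvPolynomial.aeval G (MvPolynomial.aeval F _))
        rw [← AlgHom.comp_apply φg, hφG, ← AlgHom.comp_apply φf, hφF]
      · refine (MvPolynomial.isHomogeneous_X _ _).sub ?_
        change (MvPolynomial.aeval G (MvPolynomial.aeval F (MvPolynomial.X j))).IsHomogeneous 1
        rw [MvPolynomial.aeval_X]
        simpa using (hF j).aeval G hG
    intro P
    exact Ideal.Quotient.eq.mp (DFunLike.congr_fun hcomp P).symm
  refine le_antisymm (fun P hP => ?_) (Ideal.span_le.mpr fun P hP => hP.1)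
  have h1 : MvPolynomial.aeval F P ∈ reesKer f := (DFunLike.congr_fun hφF P).trans hP
  simpa using M.add_mem (hsub P) (hback _ h1)

end GeneratingSets

section EvenCycle

variable {k : Type*} [Field k] {n : ℕ}

/-- The edge monomials `xᵢ xᵢ₊₁` of the cycle of length `n`. -/
noncomputable def cycleEdge (k : Type*) [Field k] (n : ℕ) (i : Fin n) : MvPolynomial (Fin n) k :=
  MvPolynomial.X i * MvPolynomial.X (cycSucc i)

theorem prod_cycleEdge (α : Fin n →₀ ℕ) :
    (α.prod fun i m => (Polynomial.C (cycleEdge k n i) * Polynomial.X) ^ m) =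
      Polynomial.monomial α.degree (MvPolynomial.monomial (cycIncidence α) (1 : k)) := by
  induction α using Finsupp.induction_linear with
  | zero => simp [cycIncidence_zero]
  | add α β hα hβ =>
    rw [Finsupp.prod_add_index' (by simp) (by simp [pow_add]), hα, hβ,
      Polynomial.monomial_mul_monomial, MvPolynomial.monomial_mul, cycIncidence_add]
    simp
  | single i m =>
    induction m with
    | zero => simp [cycIncidence_zero]
    | succ m ih =>
      rw [Finsupp.prod_single_index (by simp)] at ih ⊢
      rw [pow_succ, ih, Finsupp.single_add, cycIncidence_add, cycIncidence_single, map_add,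
        ← Polynomial.monomial_one_one_eq_X, Polynomial.C_mul_monomial,
        Polynomial.monomial_mul_monomial, cycleEdge, MvPolynomial.X, MvPolynomial.X, mul_one,
        MvPolynomial.monomial_mul, MvPolynomial.monomial_mul]
      simp

/-- The presentation of the Rees algebra of the edge ideal of a cycle, on monomials. -/
theorem aeval_cycleEdge (a α : Fin n →₀ ℕ) (c : k) :
    MvPolynomial.aeval (fun i => Polynomial.C (cycleEdge k n i) * Polynomial.X)
      (MvPolynomial.monomial α (MvPolynomial.monomial a c)) =
    Polynomial.monomial α.degree (MvPolynomial.monomial (a + cycIncidence α) c) := by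
  rw [MvPolynomial.aeval_monomial, prod_cycleEdge, Polynomial.algebraMap_eq,
    Polynomial.C_mul_monomial, MvPolynomial.monomial_mul, mul_one]

theorem reesMonomial_sub_mem_reesKer {a α b β : Fin n →₀ ℕ} (h : SameImage a α b β) :
    reesMonomial k a α - reesMonomial k b β ∈ reesKer (cycleEdge k n) := by
  rw [mem_reesKer, map_sub, reesMonomial, reesMonomial, aeval_cycleEdge, aeval_cycleEdge, h.1, h.2,
    sub_self]

/-- An ideal containing all binomial relations contains the whole ideal of equations. -/
theorem reesKer_cycleEdge_le {M : Ideal (MvPolynomial (Fin n) (MvPolynomial (Fin n) k))}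
    (hM : ∀ a α b β, SameImage a α b β → reesMonomial k a α - reesMonomial k b β ∈ M) :
    reesKer (cycleEdge k n) ≤ M := by
  classical
  let B := (MvPolynomial.basisMonomials (Fin n) k).smulTower
    (Polynomial.basisMonomials (MvPolynomial (Fin n) k))
  have hB : ∀ e q c, Polynomial.monomial q (MvPolynomial.monomial e c) = c • B (e, q) := by
    intro e q c
    simp [B, Module.Basis.smulTower_apply, Polynomial.smul_monomial, MvPolynomial.smul_monomial]
  let σ : (Fin n →₀ ℕ) × ℕ → MvPolynomial (Fin n) (MvPolynomial (Fin n) k) := fun e =>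
    if h : ∃ b β : Fin n →₀ ℕ, b + cycIncidence β = e.1 ∧ β.degree = e.2 then
      reesMonomial k h.choose h.choose_spec.choose else 0
  have hσ : ∀ a α, reesMonomial k a α - σ (a + cycIncidence α, α.degree) ∈ M := by
    intro a α
    have h : ∃ b β : Fin n →₀ ℕ, b + cycIncidence β = a + cycIncidence α ∧ β.degree = α.degree :=
      ⟨a, α, rfl, rfl⟩
    simp only [σ, dif_pos h]
    exact hM _ _ _ _ ⟨h.choose_spec.choose_spec.1.symm, h.choose_spec.choose_spec.2.symm⟩
  let S := B.constr k σ
  have hS : ∀ P, P - S (MvPolynomial.aeval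
      (fun i => Polynomial.C (cycleEdge k n i) * Polynomial.X) P) ∈ M := by
    have hadd : ∀ P Q, P - S (MvPolynomial.aeval
          (fun i => Polynomial.C (cycleEdge k n i) * Polynomial.X) P) ∈ M →
        Q - S (MvPolynomial.aeval
          (fun i => Polynomial.C (cycleEdge k n i) * Polynomial.X) Q) ∈ M →
        P + Q - S (MvPolynomial.aeval
          (fun i => Polynomial.C (cycleEdge k n i) * Polynomial.X) (P + Q)) ∈ M := by
      intro P Q hP hQ
      rw [map_add, map_add, add_sub_add_comm]
      exact M.add_mem hP hQ
    intro P
    induction P using MvPolynomial.induction_on' with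
    | add P Q hP hQ => exact hadd P Q hP hQ
    | monomial α r =>
      induction r using MvPolynomial.induction_on' with
      | add r r' hr hr' =>
        rw [map_add (MvPolynomial.monomial α)]
        exact hadd _ _ hr hr'
      | monomial a c =>
        have hc : MvPolynomial.monomial α (MvPolynomial.monomial a c) =
            c • reesMonomial k a α := by
          simp [reesMonomial, MvPolynomial.smul_monomial]
        rw [aeval_cycleEdge, hB, map_smul, Module.Basis.constr_basis, hc, ← smul_sub]
        exact Submodule.smul_of_tower_mem M c (hσ a α)
  intro P hP
  have := hS P
  rwa [mem_reesKer.mp hP, map_zero, sub_zero] at this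

theorem genInDegLE_cycleEdge {p : ℕ} (hp : 1 ≤ p) :
    GenInDegLE (reesKer (cycleEdge k (2 * p))) p := by
  refine le_antisymm (reesKer_cycleEdge_le fun a α b β h => ?_)
    (Ideal.span_le.mpr fun P hP => hP.1)
  refine reesMonomial_sub_mem hp (fun a α b β h hα => ?_) _ a α b β h rfl
  exact Ideal.subset_span ⟨reesMonomial_sub_mem_reesKer h, α.degree, hα,
    (MvPolynomial.isHomogeneous_monomial _ rfl).sub
      (MvPolynomial.isHomogeneous_monomial _ h.2.symm)⟩

/-- Equations of the even cycle have no pure `t`-part in degrees less than `p`. -/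
theorem coeff_zero_of_mem_reesKer {p : ℕ}
    {P : MvPolynomial (Fin (2 * p)) (MvPolynomial (Fin (2 * p)) k)}
    (hP : P ∈ reesKer (cycleEdge k (2 * p))) {α : Fin (2 * p) →₀ ℕ} (hα : α.degree < p) :
    MvPolynomial.coeff 0 (MvPolynomial.coeff α P) = 0 := by
  classical
  have key : ∀ P : MvPolynomial (Fin (2 * p)) (MvPolynomial (Fin (2 * p)) k),
      MvPolynomial.coeff 0 (MvPolynomial.coeff α P) =
      MvPolynomial.coeff (cycIncidence α) (Polynomial.coeff (MvPolynomial.aeval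
        (fun i => Polynomial.C (cycleEdge k (2 * p) i) * Polynomial.X) P) α.degree) := by
    intro P
    induction P using MvPolynomial.induction_on' with
    | add P Q hP hQ => simp [hP, hQ]
    | monomial β r =>
      induction r using MvPolynomial.induction_on' with
      | add r r' hr hr' =>
        rw [map_add (MvPolynomial.monomial β), map_add, MvPolynomial.coeff_add,
          MvPolynomial.coeff_add, Polynomial.coeff_add, MvPolynomial.coeff_add, hr, hr']
      | monomial b c =>
        rw [aeval_cycleEdge, MvPolynomial.coeff_monomial, Polynomial.coeff_monomial]
        by_cases hβ : β = α
        · subst hβ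
          simp [MvPolynomial.coeff_monomial]
        · rw [if_neg hβ]
          split_ifs with hd
          · rw [MvPolynomial.coeff_zero, MvPolynomial.coeff_monomial, if_neg]
            intro he
            have hdeg := congrArg Finsupp.degree he
            rw [map_add, degree_cycIncidence, degree_cycIncidence, hd] at hdeg
            have hb : b = 0 := (Finsupp.degree_eq_zero_iff b).mp (by omega)
            rw [hb, zero_add] at he
            exact hβ (eq_of_cycIncidence_eq hα he.symm).symm
          · simp
  rw [key, mem_reesKer.mp hP, Polynomial.coeff_zero, MvPolynomial.coeff_zero]

theorem le_of_genInDegLE_cycleEdge {p N : ℕ} (hp : 1 ≤ p)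
    (h : GenInDegLE (reesKer (cycleEdge k (2 * p))) N) : p ≤ N := by
  classical
  by_contra! hN
  let ψ := MvPolynomial.map (σ := Fin (2 * p))
    (MvPolynomial.constantCoeff : MvPolynomial (Fin (2 * p)) k →+* k)
  have hle : reesKer (cycleEdge k (2 * p)) ≤ RingHom.ker ψ := by
    rw [h, Ideal.span_le]
    rintro P ⟨hP, q, hq, hPq⟩
    refine MvPolynomial.ext _ _ fun α => ?_
    rw [MvPolynomial.coeff_map, MvPolynomial.coeff_zero]
    by_cases hα : α.degree = q
    · exact coeff_zero_of_mem_reesKer hP (by omega)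
    · rw [hPq.coeff_eq_zero hα, map_zero]
  have hmem : reesMonomial k 0 (parityInd p 0) - reesMonomial k 0 (parityInd p 1) ∈
      reesKer (cycleEdge k (2 * p)) :=
    reesMonomial_sub_mem_reesKer ⟨by rw [cycIncidence_parityInd_eq two_pos one_lt_two],
      by rw [degree_parityInd two_pos, degree_parityInd one_lt_two]⟩
  have hne : parityInd p 1 ≠ parityInd p 0 := by
    intro h
    have := DFunLike.congr_fun h ⟨0, by omega⟩
    simp [parityInd_apply] at this
  have h0 := congrArg (MvPolynomial.coeff (parityInd p 0)) (hle hmem)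
  simp [ψ, reesMonomial, MvPolynomial.coeff_monomial, hne] at h0

end EvenCycle

/-- For `p ≥ 1` and `n = 2p`, the edge ideal `I = (x₁x₂, x₂x₃, …, x_{n-1}xₙ, xₙx₁)` of a cycle
of even length `n` in `k[x₁,…,xₙ]` has relation type `p`. -/
theorem relType_edge_ideal_even_cycle {k : Type*} [Field k] (p : ℕ) (hp : 1 ≤ p) :
    relType (Ideal.span (Set.range fun i : Fin (2 * p) =>
      (X i : MvPolynomial (Fin (2 * p)) k) *
        X ⟨((i : ℕ) + 1) % (2 * p), Nat.mod_lt _ (by omega)⟩)) = p := by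
  refine IsLeast.csInf_eq ⟨⟨hp, fun s f hf => ?_⟩, fun N hN => ?_⟩
  · exact (genInDegLE_cycleEdge hp).of_span_eq hp hf.symm
  · exact le_of_genInDegLE_cycleEdge hp (hN.2 (2 * p) (cycleEdge k (2 * p)) rfl)
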